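/- Let w ∈ W be in reduced form and satisfy Hypothesis (L). Then w(i) ≠ i for all i with 1 ≤ i ≤ n. -/

import Mathlib

/-!  Common framework: Weyl groups of classical groups, modeled as permutations of ℕ
supported on `{1,…,r₀}`, with the convention `i' = r₀ + 1 - i`. -/

/-- `IsWfull r₀ w`: `w` fixes every point outside `{1,…,r₀}` and commutes with the
involution `ι : i ↦ r₀ + 1 - i` on `{1,…,r₀}`.  This is the full group of permutations
of `{1,…,r₀}` commuting with `ι` (the Weyl group of `SO(2r+1)`, `U(2r+1)` or `U(2r)`). -/
def IsWfull (r₀ : ℕ) (w : Equiv.Perm ℕ) : Prop :=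
  (∀ i : ℕ, ¬(1 ≤ i ∧ i ≤ r₀) → w i = i) ∧
  (∀ i : ℕ, 1 ≤ i → i ≤ r₀ → w (r₀ + 1 - i) = r₀ + 1 - w i)

/-- The parity condition singling out the Weyl group of `SO(2r)`:
the number of indices `1 ≤ i ≤ r` with `w i > r` is even. -/
def EvenCond (r : ℕ) (w : Equiv.Perm ℕ) : Prop :=
  Even (((Finset.Icc 1 r).filter (fun i => r < w i)).card)

/-- Membership in `W`; the proposition `so2r` indicates whether we are in the `SO(2r)`
case (where the parity condition is imposed on top of `IsWfull`). -/
def MemW (r r₀ : ℕ) (so2r : Prop) (w : Equiv.Perm ℕ) : Prop :=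
  IsWfull r₀ w ∧ (so2r → EvenCond r w)

/-- Membership in `W_M`: an element of `W` with `w({1,…,n}) = {1,…,n}` and
`w({n+1,…,r₀−n}) = {n+1,…,r₀−n}`. -/
def MemWM (r r₀ n : ℕ) (so2r : Prop) (m : Equiv.Perm ℕ) : Prop :=
  MemW r r₀ so2r m ∧
  (Finset.Icc 1 n).image (fun i => m i) = Finset.Icc 1 n ∧
  (Finset.Icc (n + 1) (r₀ - n)).image (fun i => m i) = Finset.Icc (n + 1) (r₀ - n)

/-- The left coset `w·{m | P m}`. -/
def coset (P : Equiv.Perm ℕ → Prop) (w : Equiv.Perm ℕ) : Set (Equiv.Perm ℕ) :=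
  {x | ∃ m, P m ∧ x = w * m}

/-- `w` is in standard form: a product of pairwise disjoint transpositions
`∏ᵢ (aᵢ aᵢ') · ∏ᵢ (bᵢ cᵢ)(cᵢ' bᵢ')` with `aᵢ, bᵢ ∈ {1,…,n}` and `cᵢ ∈ {n+1,…,r₀−n}`.
This is encoded pointwise: `w` belongs to the full group `W`, is an involution, every
moved point `i ∈ {1,…,n}` has `w i = i'` or `w i ∈ {n+1,…,r₀−n}`, and every moved
point `i ∈ {n+1,…,r₀−n}` has `w i ∈ {1,…,n}` or `w i ∈ {n',…,r₀}`. -/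
def IsStandardForm (r₀ n : ℕ) (w : Equiv.Perm ℕ) : Prop :=
  IsWfull r₀ w ∧ w * w = 1 ∧
  (∀ i, 1 ≤ i → i ≤ n → w i ≠ i →
    (w i = r₀ + 1 - i ∨ (n + 1 ≤ w i ∧ w i ≤ r₀ - n))) ∧
  (∀ i, n + 1 ≤ i → i ≤ r₀ - n → w i ≠ i →
    (w i ≤ n ∨ r₀ + 1 - n ≤ w i))

/-- The 4-cycle `(a b c d)` sending `a ↦ b ↦ c ↦ d ↦ a`. -/
def cycle4 (a b c d : ℕ) : Equiv.Perm ℕ :=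
  Equiv.swap a b * Equiv.swap b c * Equiv.swap c d

/-- `w` is in reduced form: `w = w₁ w₂` with `w₁` in standard form, `w₂` disjoint from
`w₁`, and `w₂` either the identity, or (only in the `SO(2r)` case) a transposition
`(d₀ d₀')` with `n+1 ≤ d₀ ≤ r`, or a 4-cycle `(i₀ j₀' i₀' j₀)` with `1 ≤ i₀ ≤ n < j₀ ≤ r`. -/
def IsReducedForm (r r₀ n : ℕ) (so2r : Prop) (w : Equiv.Perm ℕ) : Prop :=
  ∃ w₁ w₂ : Equiv.Perm ℕ,
    IsStandardForm r₀ n w₁ ∧ w = w₁ * w₂ ∧ Equiv.Perm.Disjoint w₁ w₂ ∧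
    (w₂ = 1 ∨
      (so2r ∧
        ((∃ d₀, n + 1 ≤ d₀ ∧ d₀ ≤ r ∧ w₂ = Equiv.swap d₀ (r₀ + 1 - d₀)) ∨
         (∃ i₀ j₀, 1 ≤ i₀ ∧ i₀ ≤ n ∧ n < j₀ ∧ j₀ ≤ r ∧
            w₂ = cycle4 i₀ (r₀ + 1 - j₀) (r₀ + 1 - i₀) j₀))))

/-- The vector `e_i : {1,…,r₀} → ℤ` with `e_i(i) = 1`, `e_i(i') = −1`, `0` elsewhere. -/
def evec (r₀ i : ℕ) : ℕ → ℤ :=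
  fun k => if k = i then 1 else if k = r₀ + 1 - i then -1 else 0

/-- The simple root `α_i = e_i − e_{i+1}`. -/
def rootAlpha (r₀ i : ℕ) : ℕ → ℤ := evec r₀ i - evec r₀ (i + 1)

/-- The root `β = e_ℓ + e_{ℓ+1}`. -/
def rootBeta (r₀ l : ℕ) : ℕ → ℤ := evec r₀ l + evec r₀ (l + 1)

/-- The action of `w` on root vectors: `(w·v)(k) = v(w⁻¹ k)`. -/
def pact (w : Equiv.Perm ℕ) (v : ℕ → ℤ) : ℕ → ℤ := fun k => v (w⁻¹ k)

/-- The set `X = {α_1,…,α_ℓ, β}`. -/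
def Xset (r₀ l : ℕ) : Set (ℕ → ℤ) :=
  {v | (∃ i, 1 ≤ i ∧ i ≤ l ∧ v = rootAlpha r₀ i) ∨ v = rootBeta r₀ l}

/-- The set of short and long roots `{e_i, 2e_i : 1 ≤ i ≤ n}` from which `S₀` is drawn. -/
def ShortLong (r₀ n : ℕ) : Set (ℕ → ℤ) :=
  {v | ∃ i, 1 ≤ i ∧ i ≤ n ∧ (v = evec r₀ i ∨ v = evec r₀ i + evec r₀ i)}

/-- `Σ_P^+ = {e_i ± e_j : 1 ≤ i ≤ n < j ≤ r} ∪ {e_i + e_j : 1 ≤ i < j ≤ n} ∪ S₀`. -/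
def SigmaP (r r₀ n : ℕ) (S₀ : Set (ℕ → ℤ)) : Set (ℕ → ℤ) :=
  {v | ∃ i j, 1 ≤ i ∧ i ≤ n ∧ n < j ∧ j ≤ r ∧
        (v = evec r₀ i - evec r₀ j ∨ v = evec r₀ i + evec r₀ j)} ∪
  {v | ∃ i j, 1 ≤ i ∧ i < j ∧ j ≤ n ∧ v = evec r₀ i + evec r₀ j} ∪ S₀

/-- Hypothesis (E): `w·α ∉ X` for every `α ∈ Σ_P^+`. -/
def HypE (r r₀ n l : ℕ) (S₀ : Set (ℕ → ℤ)) (w : Equiv.Perm ℕ) : Prop :=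
  ∀ α ∈ SigmaP r r₀ n S₀, pact w α ∉ Xset r₀ l

/-- Hypothesis (L): `α_ℓ = w·α` for some `α ∈ Σ_P^+`; no other element of `X` is of the
form `w·α` with `α ∈ Σ_P^+`; and `w⁻¹·α_ℓ` is not of the form `e_i + e_j` with
`1 ≤ i, j ≤ n`. -/
def HypL (r r₀ n l : ℕ) (S₀ : Set (ℕ → ℤ)) (w : Equiv.Perm ℕ) : Prop :=
  (∃ α ∈ SigmaP r r₀ n S₀, pact w α = rootAlpha r₀ l) ∧
  (∀ α ∈ SigmaP r r₀ n S₀, pact w α ∈ Xset r₀ l → pact w α = rootAlpha r₀ l) ∧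
  ¬ ∃ i j, 1 ≤ i ∧ i ≤ n ∧ 1 ≤ j ∧ j ≤ n ∧
      pact w⁻¹ (rootAlpha r₀ l) = evec r₀ i + evec r₀ j

/-- The permutation `(1 r₀)(2 r₀−1)⋯(n n')`. -/
def w0base (r₀ n : ℕ) : Equiv.Perm ℕ :=
  (((List.range n).map (fun i => Equiv.swap (i + 1) (r₀ - i))).prod)

theorem evec_reflect {r₀ b : ℕ} (hb : b ≤ r₀) (h : 2 * b ≠ r₀ + 1) :
    evec r₀ (r₀ + 1 - b) = -evec r₀ b := by
  funext k
  simp only [evec, Pi.neg_apply]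
  split_ifs <;> first | rfl | omega

theorem IsWfull.inv_mem {r₀ : ℕ} {w : Equiv.Perm ℕ} (hw : IsWfull r₀ w) {k : ℕ}
    (h1 : 1 ≤ k) (h2 : k ≤ r₀) : 1 ≤ w⁻¹ k ∧ w⁻¹ k ≤ r₀ := by
  by_contra h
  have h3 := hw.1 _ h
  rw [Equiv.Perm.coe_inv, Equiv.apply_symm_apply] at h3
  exact h (h3 ▸ ⟨h1, h2⟩)

theorem IsWfull.apply_reflect_inv {r₀ : ℕ} {w : Equiv.Perm ℕ} (hw : IsWfull r₀ w) {k : ℕ}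
    (h1 : 1 ≤ k) (h2 : k ≤ r₀) : w (r₀ + 1 - w⁻¹ k) = r₀ + 1 - k := by
  have h := hw.inv_mem h1 h2
  rw [hw.2 _ h.1 h.2, Equiv.Perm.coe_inv, Equiv.apply_symm_apply]

theorem IsWfull.two_mul_inv_ne {r₀ : ℕ} {w : Equiv.Perm ℕ} (hw : IsWfull r₀ w) {k : ℕ}
    (h1 : 1 ≤ k) (h2 : k ≤ r₀) (h : 2 * k ≠ r₀ + 1) : 2 * w⁻¹ k ≠ r₀ + 1 := by
  intro h3
  have h4 := hw.apply_reflect_inv h1 h2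
  rw [show r₀ + 1 - w⁻¹ k = w⁻¹ k by omega, Equiv.Perm.coe_inv, Equiv.apply_symm_apply] at h4
  omega

theorem pact_add (w : Equiv.Perm ℕ) (u v : ℕ → ℤ) : pact w (u + v) = pact w u + pact w v := rfl

theorem pact_sub (w : Equiv.Perm ℕ) (u v : ℕ → ℤ) : pact w (u - v) = pact w u - pact w v := rfl

theorem pact_inv_pact (w : Equiv.Perm ℕ) (v : ℕ → ℤ) : pact w⁻¹ (pact w v) = v := by
  funext k
  simp [pact]

theorem IsWfull.pact_evec {r₀ : ℕ} {w : Equiv.Perm ℕ} (hw : IsWfull r₀ w) {k : ℕ}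
    (h1 : 1 ≤ k) (h2 : k ≤ r₀) : pact w (evec r₀ (w⁻¹ k)) = evec r₀ k := by
  funext m
  have h : w⁻¹ m = r₀ + 1 - w⁻¹ k ↔ m = r₀ + 1 - k := by
    rw [Equiv.Perm.inv_eq_iff_eq, hw.apply_reflect_inv h1 h2]
  simp only [pact, evec, h, EmbeddingLike.apply_eq_iff_eq]

/-- The roots `e_a - e_b` with `a ≤ n < b`, where `b` may exceed `r`, lie in `Σ_P^+`. -/
theorem sub_mem_SigmaP {r r₀ n a b : ℕ} (S₀ : Set (ℕ → ℤ))
    (hr₀ : r₀ = 2 * r ∨ r₀ = 2 * r + 1) (ha : 1 ≤ a) (han : a ≤ n) (hnb : n < b)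
    (hb : b ≤ r₀) (hne : b ≠ r₀ + 1 - a) (hmid : 2 * b ≠ r₀ + 1) :
    evec r₀ a - evec r₀ b ∈ SigmaP r r₀ n S₀ := by
  by_cases hbr : b ≤ r
  · exact .inl (.inl ⟨a, b, ha, han, hnb, hbr, .inl rfl⟩)
  rw [sub_eq_add_neg, ← evec_reflect hb hmid]
  rcases lt_or_ge n (r₀ + 1 - b) with h | h
  · exact .inl (.inl ⟨a, _, ha, han, h, by omega, .inr rfl⟩)
  rcases lt_or_ge a (r₀ + 1 - b) with h' | h'
  · exact .inl (.inr ⟨a, _, ha, h', h, rfl⟩)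
  · exact .inl (.inr ⟨r₀ + 1 - b, a, by omega, by omega, han, add_comm _ _⟩)

theorem rootAlpha_ne {r₀ i l : ℕ} (hil : i < l) (hl : 2 * (l + 1) ≤ r₀) :
    rootAlpha r₀ i ≠ rootAlpha r₀ l := by
  intro h
  have h1 := congrFun h (l + 1)
  simp only [rootAlpha, evec, Pi.sub_apply] at h1
  split_ifs at h1 <;> omega

theorem rootBeta_ne_rootAlpha (r₀ l : ℕ) :
    rootBeta r₀ l ≠ rootAlpha r₀ l := by
  intro h
  have h1 := congrFun h (l + 1)
  simp only [rootAlpha, rootBeta, evec, Pi.sub_apply, Pi.add_apply] at h1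
  split_ifs at h1 <;> omega

/-- if `w ∈ W` is in reduced form and satisfies Hypothesis (L), then
`w i ≠ i` for all `1 ≤ i ≤ n`. -/
theorem stmt14 (r n ℓ r₀ : ℕ) (so2r : Prop)
    (hn : 1 ≤ n) (hnl : n ≤ ℓ) (hlr : ℓ + 1 ≤ r)
    (hr₀ : r₀ = 2 * r ∨ r₀ = 2 * r + 1) (hso : so2r → r₀ = 2 * r)
    (S₀ : Set (ℕ → ℤ)) (hS₀ : S₀ ⊆ ShortLong r₀ n)
    (w : Equiv.Perm ℕ) (hw : MemW r r₀ so2r w)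
    (hred : IsReducedForm r r₀ n so2r w)
    (hL : HypL r r₀ n ℓ S₀ w) :
    ∀ i, 1 ≤ i → i ≤ n → w i ≠ i := by
  intro i hi1 hin hwi
  have hW := hw.1
  obtain ⟨-, hX, hns⟩ := hL
  have hne : ∀ j, 1 ≤ j → j ≤ ℓ → w⁻¹ (j + 1) ≠ r₀ + 1 - w⁻¹ j := fun j h1 h2 h => by
    have h3 := hW.apply_reflect_inv h1 (by omega)
    rw [← h, Equiv.Perm.coe_inv, Equiv.apply_symm_apply] at h3
    omega
  -- the simple roots `α_j` with `j < ℓ` force `w⁻¹ j ≤ n` to propagate from `j = i` to `j = ℓ`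
  have hprop : ∀ j, i ≤ j → j ≤ ℓ → w⁻¹ j ≤ n := by
    intro j hij
    induction j, hij using Nat.le_induction with
    | base => exact fun _ => by rwa [Equiv.Perm.inv_eq_iff_eq.2 hwi.symm]
    | succ j hij ih =>
      intro hj
      by_contra! hlt
      have hact : pact w (evec r₀ (w⁻¹ j) - evec r₀ (w⁻¹ (j + 1))) = rootAlpha r₀ j := by
        rw [pact_sub, hW.pact_evec (by omega) (by omega), hW.pact_evec (by omega) (by omega)]
        rfl
      have hmem := sub_mem_SigmaP S₀ hr₀ (hW.inv_mem (by omega) (by omega)).1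
        (ih (by omega)) hlt (hW.inv_mem (by omega) (by omega)).2 (hne j (by omega) (by omega))
        (hW.two_mul_inv_ne (by omega) (by omega) (by omega))
      have h := hX _ hmem (hact ▸ .inl ⟨j, by omega, by omega, rfl⟩)
      exact rootAlpha_ne (by omega) (by omega) (hact.symm.trans h)
  have ha := hprop ℓ (by omega) le_rfl
  have ha1 := (hW.inv_mem (k := ℓ) (by omega) (by omega)).1
  have hb := hW.inv_mem (k := ℓ + 1) (by omega) (by omega)
  have hmid := hW.two_mul_inv_ne (k := ℓ + 1) (by omega) (by omega) (by omega)
  have hab : w⁻¹ ℓ ≠ w⁻¹ (ℓ + 1) := by simp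
  have hl := hW.pact_evec (k := ℓ) (by omega) (by omega)
  have hl' := hW.pact_evec (k := ℓ + 1) (by omega) (by omega)
  rcases lt_or_ge n (r₀ + 1 - w⁻¹ (ℓ + 1)) with h | h
  · have hmem := sub_mem_SigmaP S₀ hr₀ ha1 ha h (by omega) (by omega) (by omega)
    rw [evec_reflect hb.2 hmid, sub_neg_eq_add] at hmem
    have hact : pact w (evec r₀ (w⁻¹ ℓ) + evec r₀ (w⁻¹ (ℓ + 1))) = rootBeta r₀ ℓ := by
      rw [pact_add, hl, hl']
      rfl
    exact rootBeta_ne_rootAlpha _ _ (hact.symm.trans (hX _ hmem (hact ▸ .inr rfl)))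
  · refine hns ⟨w⁻¹ ℓ, r₀ + 1 - w⁻¹ (ℓ + 1), ha1, ha, by omega, h, ?_⟩
    rw [rootAlpha, ← hl, ← hl', ← pact_sub, pact_inv_pact, evec_reflect hb.2 hmid,
      sub_eq_add_neg]
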